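/- Let D be a dissipation distance density. Then there exists an open neighborhood U of SO(3) contained in GL₊(3) such that for every F ∈ U the zero set of the Hessian quadratic form, {G ∈ ℝ^{3×3} : ∂²_{F₁²}D²(F,F)[G,G] = 0}, equals {A·F : A ∈ ℝ^{3×3} skew}, which coincides with F^{−T}·{B ∈ ℝ^{3×3} : B skew}. -/

import Mathlib

open Matrix Filter Topology

noncomputable section

attribute [local instance] Matrix.normedAddCommGroup Matrix.normedSpace

/-- Real `3 × 3` matrices. -/
abbrev Mat3 := Matrix (Fin 3) (Fin 3) ℝ

/-- Squared Frobenius norm. -/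
def frobSq (A : Mat3) : ℝ := ∑ i, ∑ j, (A i j) ^ 2

/-- Frobenius norm. -/
def frobNorm (A : Mat3) : ℝ := Real.sqrt (frobSq A)

/-- Symmetric part of a matrix. -/
def symPart (A : Mat3) : Mat3 := (2 : ℝ)⁻¹ • (A + Aᵀ)

/-- Matrices with positive determinant. -/
def GLp : Set Mat3 := {F | 0 < F.det}

/-- The special orthogonal group `SO(3)`. -/
def SO3 : Set Mat3 := {Q | Qᵀ * Q = 1 ∧ Q.det = 1}

/-- The second Fréchet derivative of `F ↦ D(F, F₂)²` at `F₁`, applied to `(G, H)`. -/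
def D2bil (D : Mat3 → Mat3 → ℝ) (F₁ F₂ G H : Mat3) : ℝ :=
  iteratedFDeriv ℝ 2 (fun F => (D F F₂) ^ 2) F₁ ![G, H]

/-- A dissipation distance density `D : GL₊(3) × GL₊(3) → [0,∞)`, satisfying
conditions (i)–(vi). -/
structure IsDissipationDensity (D : Mat3 → Mat3 → ℝ) : Prop where
  nonneg : ∀ F₁ ∈ GLp, ∀ F₂ ∈ GLp, 0 ≤ D F₁ F₂
  eq_zero : ∀ F₁ ∈ GLp, ∀ F₂ ∈ GLp, F₁ᵀ * F₁ = F₂ᵀ * F₂ → D F₁ F₂ = 0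
  pos_of_ne : ∀ F₁ ∈ GLp, ∀ F₂ ∈ GLp, F₁ᵀ * F₁ ≠ F₂ᵀ * F₂ → 0 < D F₁ F₂
  symm : ∀ F₁ ∈ GLp, ∀ F₂ ∈ GLp, D F₁ F₂ = D F₂ F₁
  triangle : ∀ F₁ ∈ GLp, ∀ F₂ ∈ GLp, ∀ F₃ ∈ GLp, D F₁ F₃ ≤ D F₁ F₂ + D F₂ F₃
  smooth : ∃ V : Set (Mat3 × Mat3), IsOpen V ∧ SO3 ×ˢ SO3 ⊆ V ∧ V ⊆ GLp ×ˢ GLp ∧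
    ContDiffOn ℝ 3 (fun p : Mat3 × Mat3 => (D p.1 p.2) ^ 2) V
  frame_indiff : ∀ Q₁ ∈ SO3, ∀ Q₂ ∈ SO3, ∀ F₁ ∈ GLp, ∀ F₂ ∈ GLp,
    D (Q₁ * F₁) (Q₂ * F₂) = D F₁ F₂
  coercive : ∃ c > (0 : ℝ), ∀ G : Mat3, c * frobSq (symPart G) ≤ D2bil D 1 1 G G


lemma taylor2 {E : Type*} [NormedAddCommGroup E] [NormedSpace ℝ E] (f : E → ℝ) (x : E)
    (hf : ContDiffAt ℝ 2 f x) (h0 : f x = 0) (h1 : fderiv ℝ f x = 0) (K : ℝ → E) (G : E)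
    (hK : Tendsto K (𝓝[≠] 0) (𝓝 G)) :
    Tendsto (fun t : ℝ => f (x + t • K t) / t ^ 2) (𝓝[≠] 0)
      (𝓝 (fderiv ℝ (fderiv ℝ f) x G G / 2)) := by
  set B := fderiv ℝ (fderiv ℝ f) x with hB
  have hd : ∀ᶠ y in 𝓝 x, ContDiffAt ℝ 2 f y := hf.eventually (by simp)
  have hff : ContDiffAt ℝ 1 (fderiv ℝ f) x := hf.fderiv_right (by norm_num)
  have hB' : HasFDerivAt (fderiv ℝ f) B x := (hff.differentiableAt (by simp)).hasFDerivAt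
  have hsym : ∀ u v, B u v = B v u := by
    have := hf.isSymmSndFDerivAt (by simp)
    intro u v; exact this u v
  -- remainder
  have key : ∀ ε > 0, ∀ᶠ h in 𝓝 (0 : E), |f (x + h) - B h h / 2| ≤ ε * ‖h‖ ^ 2 := by
    intro ε hε
    have h2 := (hasFDerivAt_iff_isLittleO.1 hB').def hε
    obtain ⟨r, hr, hball⟩ := Metric.eventually_nhds_iff_ball.1 (hd.and h2)
    filter_upwards [Metric.ball_mem_nhds (0 : E) hr] with h hh
    have hhr : ‖h‖ < r := by simpa using hh
    have hder : ∀ t ∈ Set.Icc (0 : ℝ) 1, HasDerivWithinAt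
        (fun t : ℝ => f (x + t • h) - t ^ 2 * (B h h / 2))
        (fderiv ℝ f (x + t • h) h - t * B h h) (Set.Icc 0 1) t := by
      intro t ht
      have hm : x + t • h ∈ Metric.ball x r := by
        simp only [Metric.mem_ball, dist_self_add_left, norm_smul, Real.norm_eq_abs, abs_of_nonneg ht.1]
        nlinarith [ht.2, norm_nonneg h]
      have a := ((hball _ hm).1.differentiableAt (by simp)).hasFDerivAt
      have b : HasDerivAt (fun t : ℝ => x + t • h) h t := by
        simpa using ((hasDerivAt_id t).smul_const h).const_add x
      have c := a.comp_hasDerivAt t b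
      have d : HasDerivAt (fun t : ℝ => t ^ 2 * (B h h / 2)) (t * B h h) t := by
        refine ((hasDerivAt_pow 2 t).mul_const (B h h / 2)).congr_deriv ?_
        push_cast
        ring
      exact (c.sub d).hasDerivWithinAt
    have := norm_image_sub_le_of_norm_deriv_le_segment_01' hder (C := ε * ‖h‖ ^ 2) (by
      intro t ht
      have hm : x + t • h ∈ Metric.ball x r := by
        simp only [Metric.mem_ball, dist_self_add_left, norm_smul, Real.norm_eq_abs, abs_of_nonneg ht.1]
        nlinarith [ht.2, norm_nonneg h]
      have e := (hball _ hm).2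
      rw [h1, sub_zero, add_sub_cancel_left] at e
      have e2 := (fderiv ℝ f (x + t • h) - B (t • h)).le_opNorm h
      have e3 : (fderiv ℝ f (x + t • h) - B (t • h)) h = fderiv ℝ f (x + t • h) h - t * B h h := by
        simp
      rw [e3] at e2
      have e4 : ‖t • h‖ ≤ ‖h‖ := by
        rw [norm_smul, Real.norm_eq_abs, abs_of_nonneg ht.1]
        nlinarith [ht.2, norm_nonneg h]
      calc _ ≤ _ := e2
        _ ≤ (ε * ‖h‖) * ‖h‖ := by gcongr; exact e.trans (by gcongr)
        _ = _ := by ring)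
    simpa [h0] using this
  have ht0 : Tendsto (fun t : ℝ => t) (𝓝[≠] 0) (𝓝 0) := tendsto_nhdsWithin_of_tendsto_nhds tendsto_id
  have hsm : Tendsto (fun t : ℝ => t • K t) (𝓝[≠] 0) (𝓝 0) := by
    simpa using ht0.smul hK
  have hlim1 : Tendsto (fun t => B (K t) (K t) / 2) (𝓝[≠] 0) (𝓝 (B G G / 2)) := by
    have : Continuous fun u : E => B u u / 2 := by fun_prop
    exact (this.tendsto G).comp hK
  have hrem : Tendsto (fun t : ℝ => f (x + t • K t) / t ^ 2 - B (K t) (K t) / 2) (𝓝[≠] 0) (𝓝 0) := by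
    rw [Metric.tendsto_nhds]
    intro ε hε
    have hKb : ∀ᶠ t in 𝓝[≠] (0:ℝ), ‖K t‖ < ‖G‖ + 1 := hK.norm.eventually_lt_const (by simp)
    have hp : 0 < ε / (2 * (‖G‖ + 1) ^ 2) := by positivity
    filter_upwards [hsm.eventually (key _ hp), hKb, self_mem_nhdsWithin] with t h1 h2 h3
    have h3 : t ≠ 0 := h3
    have ht2 : 0 < t ^ 2 := by positivity
    rw [dist_zero_right, Real.norm_eq_abs]
    have e : f (x + t • K t) / t ^ 2 - B (K t) (K t) / 2
        = (f (x + t • K t) - B (t • K t) (t • K t) / 2) / t ^ 2 := by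
      simp; field_simp
    rw [e, abs_div, abs_of_pos ht2, div_lt_iff₀ ht2]
    refine h1.trans_lt ?_
    rw [norm_smul, mul_pow, Real.norm_eq_abs, sq_abs]
    have : ‖K t‖ ^ 2 ≤ (‖G‖ + 1) ^ 2 := by gcongr
    calc _ ≤ ε / (2 * (‖G‖ + 1) ^ 2) * (t ^ 2 * (‖G‖ + 1) ^ 2) := by gcongr
      _ = ε / 2 * t ^ 2 := by field_simp
      _ < _ := by gcongr; linarith
  simpa using hrem.add hlim1

lemma GLp_open : IsOpen GLp := by
  have : Continuous fun F : Mat3 => F.det := Continuous.matrix_det continuous_id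
  exact isOpen_lt continuous_const this

lemma SO3_inv {Q : Mat3} (h : Q ∈ SO3) : Q * Qᵀ = 1 := mul_eq_one_comm.1 h.1

lemma SO3_T {Q : Mat3} (h : Q ∈ SO3) : Qᵀ ∈ SO3 := ⟨by simpa using SO3_inv h, by simpa using h.2⟩

lemma SO3_GLp {Q : Mat3} (h : Q ∈ SO3) : Q ∈ GLp := by
  show 0 < Q.det
  rw [h.2]; norm_num

lemma one_SO3 : (1 : Mat3) ∈ SO3 := by constructor <;> simp

lemma SO3_mul_GLp {Q F : Mat3} (h : Q ∈ SO3) (hF : F ∈ GLp) : Q * F ∈ GLp := by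
  show 0 < (Q * F).det
  rw [det_mul, h.2, one_mul]; exact hF

def Phi (D : Mat3 → Mat3 → ℝ) : Mat3 × Mat3 → ℝ := fun p => (D p.1 p.2) ^ 2

lemma slice (D : Mat3 → Mat3 → ℝ) {F : Mat3} (h : ContDiffAt ℝ 3 (Phi D) (F, F)) :
    ContDiffAt ℝ 3 (fun X => (D X F) ^ 2) F :=
  ContDiffAt.comp (g := Phi D) (f := fun X : Mat3 => (X, F)) F h (contDiffAt_id.prodMk contDiffAt_const)

lemma D2bil_eq (D : Mat3 → Mat3 → ℝ) (F G H : Mat3) :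
    D2bil D F F G H = fderiv ℝ (fderiv ℝ (fun X => (D X F) ^ 2)) F G H := by
  rw [D2bil, iteratedFDeriv_two_apply]; rfl

lemma limD (D : Mat3 → Mat3 → ℝ) (hD : IsDissipationDensity D) {F : Mat3} (hF : F ∈ GLp)
    (h : ContDiffAt ℝ 3 (Phi D) (F, F)) (K : ℝ → Mat3) (G : Mat3)
    (hK : Tendsto K (𝓝[≠] 0) (𝓝 G)) :
    Tendsto (fun t : ℝ => (D (F + t • K t) F) ^ 2 / t ^ 2) (𝓝[≠] 0) (𝓝 (D2bil D F F G G / 2)) := by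
  rw [D2bil_eq]
  have h0 : D F F = 0 := hD.eq_zero F hF F hF rfl
  refine taylor2 (fun X => (D X F) ^ 2) F ((slice D h).of_le (by norm_num)) (by simp [h0]) ?_ K G hK
  apply IsLocalMin.fderiv_eq_zero
  refine Eventually.of_forall fun X => ?_
  simpa [h0] using sq_nonneg (D X F)

lemma contD {E : Type*} [NormedAddCommGroup E] [NormedSpace ℝ E] (φ : E → E → ℝ) {F S : E}
    (h : ContDiffAt ℝ 3 (fun p : E × E => φ p.1 p.2) (F, F)) (m : E × E → E)
    (hm : ContinuousAt m (F, S)) :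
    ContinuousAt (fun p : E × E => iteratedFDeriv ℝ 2 (fun X => φ X p.1) p.1 ![m p, m p]) (F, S) := by
  have a : ContDiffAt ℝ 2 (fun p : E × E => fderiv ℝ (fun X => φ X p.1) p.2) (F, F) := by
    refine ContDiffAt.fderiv (f := fun (p : E × E) X => φ X p.1) (g := fun p => p.2) (n := 3) ?_
      contDiffAt_snd (by norm_num)
    exact ContDiffAt.comp (g := fun p : E × E => φ p.1 p.2)
      (f := fun q : (E × E) × E => (q.2, q.1.1)) ((F, F), F) h
      (contDiffAt_snd.prodMk (contDiffAt_fst.fst))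
  have b : ContDiffAt ℝ 1 (fun F => fderiv ℝ (fderiv ℝ (fun X => φ X F)) F) F :=
    ContDiffAt.fderiv (f := fun F X => fderiv ℝ (fun X => φ X F) X) (g := fun p => p) (n := 2) a
      contDiffAt_id (by norm_num)
  have hB : ContinuousAt (fun p : E × E => fderiv ℝ (fderiv ℝ (fun X => φ X p.1)) p.1) (F, S) :=
    ContinuousAt.comp (g := fun F => fderiv ℝ (fderiv ℝ (fun X => φ X F)) F)
      b.continuousAt continuousAt_fst
  simp only [iteratedFDeriv_two_apply]
  exact (hB.clm_apply hm).clm_apply hm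

lemma cayley {A : Mat3} (hA : Aᵀ = -A) : ∃ R : ℝ → Mat3, Tendsto R (𝓝[≠] 0) (𝓝 A) ∧
    ∀ᶠ t in 𝓝[≠] (0:ℝ), 1 + t • R t ∈ SO3 := by
  set M : ℝ → Mat3 := fun t => 1 - (t / 2) • A with hM
  have hMc : Continuous M := by fun_prop
  have hM0 : M 0 = 1 := by simp [hM]
  have hdc : Continuous fun t => (M t).det := hMc.matrix_det
  have hpos : ∀ᶠ t in 𝓝 (0:ℝ), 0 < (M t).det := by
    apply hdc.continuousAt.eventually_const_lt
    simp [hM0]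
  refine ⟨fun t => (M t)⁻¹ * A, ?_, ?_⟩
  · have : ContinuousAt (fun t => (M t)⁻¹ * A) 0 := by
      simp only [Matrix.inv_def, Ring.inverse_eq_inv']
      have : ContinuousAt (fun t => ((M t).det)⁻¹) 0 := hdc.continuousAt.inv₀ (by simp [hM0])
      have h2 : ContinuousAt (fun t => (M t).adjugate * A) 0 := 
        (hMc.matrix_adjugate.matrix_mul continuous_const).continuousAt
      simp only [Matrix.smul_mul]
      exact this.smul h2
    have h3 := this.tendsto
    simp only [hM0, inv_one, one_mul] at h3
    exact h3.mono_left nhdsWithin_le_nhds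
  · filter_upwards [hpos.filter_mono nhdsWithin_le_nhds] with t ht
    have hu : IsUnit (M t).det := ht.ne'.isUnit
    have hMT : (M t)ᵀ = 1 + (t / 2) • A := by
      simp [hM, hA]
    have hcomm : (M t)ᵀ * M t = M t * (M t)ᵀ := by
      rw [hMT]; simp only [hM]
      simp only [add_mul, mul_sub, mul_add, sub_mul, one_mul, mul_one, smul_mul_assoc, mul_smul_comm]
      module
    have hQ : 1 + t • ((M t)⁻¹ * A) = (M t)⁻¹ * (M t)ᵀ := by
      have : (M t)ᵀ = M t + t • A := by
        rw [hMT]; simp only [hM]; module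
      rw [this, mul_add, nonsing_inv_mul _ hu, Matrix.mul_smul]
    have huT : IsUnit ((M t)ᵀ).det := by simpa using hu
    rw [hQ]
    constructor
    · rw [transpose_mul, transpose_transpose, transpose_nonsing_inv]
      calc M t * ((M t)ᵀ)⁻¹ * ((M t)⁻¹ * (M t)ᵀ) = M t * (((M t)ᵀ)⁻¹ * (M t)⁻¹) * (M t)ᵀ := by
            simp only [mul_assoc]
        _ = M t * ((M t * (M t)ᵀ)⁻¹) * (M t)ᵀ := by rw [Matrix.mul_inv_rev]
        _ = M t * (((M t)⁻¹) * ((M t)ᵀ)⁻¹) * (M t)ᵀ := by rw [← hcomm, Matrix.mul_inv_rev]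
        _ = (M t * (M t)⁻¹) * (((M t)ᵀ)⁻¹ * (M t)ᵀ) := by simp only [mul_assoc]
        _ = 1 := by rw [mul_nonsing_inv _ hu, nonsing_inv_mul _ huT, one_mul]
    · rw [det_mul, det_transpose, ← det_mul, nonsing_inv_mul _ hu, det_one]

lemma hess_skew (D : Mat3 → Mat3 → ℝ) (hD : IsDissipationDensity D) {F : Mat3} (hF : F ∈ GLp)
    (h : ContDiffAt ℝ 3 (Phi D) (F, F)) (A G : Mat3) (hA : Aᵀ = -A) :
    D2bil D F F (A * F + G) (A * F + G) = D2bil D F F G G := by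
  obtain ⟨R, hR, hS⟩ := cayley hA
  have ht0 : Tendsto (fun t : ℝ => t) (𝓝[≠] 0) (𝓝 0) := tendsto_nhdsWithin_of_tendsto_nhds tendsto_id
  have l1 := limD D hD hF h (fun _ => G) G tendsto_const_nhds
  have l2 := limD D hD hF h (fun t => R t * F + G + t • (R t * G)) (A * F + G) (by
    have c1 : Tendsto (fun t => R t * F) (𝓝[≠] 0) (𝓝 (A * F)) :=
      ((continuous_id.matrix_mul continuous_const).tendsto A).comp hR
    have c2 : Tendsto (fun t => R t * G) (𝓝[≠] 0) (𝓝 (A * G)) :=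
      ((continuous_id.matrix_mul continuous_const).tendsto A).comp hR
    simpa using (c1.add_const G).add (ht0.smul c2))
  have hG : ∀ᶠ t : ℝ in 𝓝[≠] 0, F + t • G ∈ GLp := by
    have : Continuous fun t : ℝ => F + t • G := by fun_prop
    exact (this.continuousAt.eventually_mem (GLp_open.mem_nhds (by simpa using hF))).filter_mono
      nhdsWithin_le_nhds
  have := tendsto_nhds_unique (l2.congr' (f₂ := fun t : ℝ => (D (F + t • G) F) ^ 2 / t ^ 2) (by
    filter_upwards [hS, hG] with t h1 h2
    have := hD.frame_indiff _ h1 1 one_SO3 _ h2 F hF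
    rw [one_mul] at this
    rw [← this]
    have e : F + t • (R t * F + G + t • (R t * G)) = (1 + t • R t) * (F + t • G) := by
     simp only [add_mul, mul_add, one_mul, smul_mul_assoc, mul_smul_comm, smul_add]
     abel
    simp only [e])) l1
  linarith

lemma hess_rot (D : Mat3 → Mat3 → ℝ) (hD : IsDissipationDensity D) {Q : Mat3} (hQ : Q ∈ SO3)
    (h : ∀ Q ∈ SO3, ContDiffAt ℝ 3 (Phi D) (Q, Q)) (G : Mat3) :
    D2bil D Q Q (Q * G) (Q * G) = D2bil D 1 1 G G := by
  have l1 := limD D hD (SO3_GLp one_SO3) (h _ one_SO3) (fun _ => G) G tendsto_const_nhds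
  have l2 := limD D hD (SO3_GLp hQ) (h _ hQ) (fun _ => Q * G) (Q * G) tendsto_const_nhds
  have hG : ∀ᶠ t : ℝ in 𝓝[≠] 0, 1 + t • G ∈ GLp := by
    have : Continuous fun t : ℝ => 1 + t • G := by fun_prop
    exact (this.continuousAt.eventually_mem (GLp_open.mem_nhds
      (by simpa using SO3_GLp one_SO3))).filter_mono nhdsWithin_le_nhds
  have := tendsto_nhds_unique (l2.congr' (f₂ := fun t : ℝ => (D (1 + t • G) 1) ^ 2 / t ^ 2) (by
    filter_upwards [hG] with t h2
    have := hD.frame_indiff _ hQ Q hQ _ h2 1 (SO3_GLp one_SO3)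
    rw [← this]
    simp [mul_add])) l1
  linarith

lemma pos_at (D : Mat3 → Mat3 → ℝ) (hD : IsDissipationDensity D) {Q : Mat3} (hQ : Q ∈ SO3)
    (h : ∀ Q ∈ SO3, ContDiffAt ℝ 3 (Phi D) (Q, Q)) (S : Mat3) (hS : Sᵀ = S) (hne : S ≠ 0) :
    0 < D2bil D Q Q (S * Q) (S * Q) := by
  obtain ⟨c, hc, hco⟩ := hD.coercive
  have e : S * Q = Q * (Qᵀ * S * Q) := by
    rw [← mul_assoc, ← mul_assoc, SO3_inv hQ, one_mul]
  rw [e, hess_rot D hD hQ h]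
  refine lt_of_lt_of_le ?_ (hco _)
  have hs : symPart (Qᵀ * S * Q) = Qᵀ * S * Q := by
    have : (Qᵀ * S * Q)ᵀ = Qᵀ * S * Q := by simp [transpose_mul, hS, mul_assoc]
    rw [symPart, this]; module
  rw [hs]
  apply mul_pos hc
  have hn : Qᵀ * S * Q ≠ 0 := by
    intro h0
    apply hne
    have : Q * (Qᵀ * S * Q) * Qᵀ = S := by
      rw [← e, mul_assoc, SO3_inv hQ, mul_one]
    rw [← this, h0]; simp
  set T := Qᵀ * S * Q
  have hnn : 0 ≤ frobSq T := by unfold frobSq; positivity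
  refine lt_of_le_of_ne hnn fun h0 => hn ?_
  ext i j
  have h1 := (Finset.sum_eq_zero_iff_of_nonneg (fun i _ => by positivity)).1 h0.symm i (Finset.mem_univ _)
  have h2 := (Finset.sum_eq_zero_iff_of_nonneg (fun i _ => by positivity)).1 h1 j (Finset.mem_univ _)
  simpa using h2

lemma pos_near (D : Mat3 → Mat3 → ℝ) (hD : IsDissipationDensity D) {Q : Mat3} (hQ : Q ∈ SO3)
    (h : ∀ Q ∈ SO3, ContDiffAt ℝ 3 (Phi D) (Q, Q)) :
    ∀ᶠ F in 𝓝 Q, ∀ S : Mat3, Sᵀ = S → S ≠ 0 → 0 < D2bil D F F (S * F) (S * F) := by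
  have : ProperSpace Mat3 := FiniteDimensional.proper_real Mat3
  have hcl : IsClosed {S : Mat3 | Sᵀ = S} :=
    isClosed_eq (continuous_id.matrix_transpose) continuous_id
  have hK : IsCompact (Metric.sphere (0 : Mat3) 1 ∩ {S : Mat3 | Sᵀ = S}) :=
    (isCompact_sphere 0 1).inter_right hcl
  have key : ∀ᶠ F in 𝓝 Q, ∀ S ∈ Metric.sphere (0 : Mat3) 1 ∩ {S : Mat3 | Sᵀ = S},
      0 < D2bil D F F (S * F) (S * F) := by
    refine hK.eventually_forall_of_forall_eventually fun S hS => ?_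
    have hp := pos_at D hD hQ h S hS.2 (by rintro rfl; simpa using hS.1)
    have hm : ContinuousAt (fun p : Mat3 × Mat3 => p.2 * p.1) (Q, S) :=
      (continuous_snd.matrix_mul continuous_fst).continuousAt
    have hc : ContinuousAt (fun p : Mat3 × Mat3 => D2bil D p.1 p.1 (p.2 * p.1) (p.2 * p.1)) (Q, S) :=
      contD (fun X Y => (D X Y) ^ 2) (h Q hQ) (fun p => p.2 * p.1) hm
    exact hc.eventually_const_lt hp
  filter_upwards [key] with F hF S hS hne
  have hn : ‖S‖ ≠ 0 := norm_ne_zero_iff.2 hne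
  have := hF (‖S‖⁻¹ • S) ⟨by simp [norm_smul, hn], by simp [hS]⟩
  rw [D2bil_eq] at this ⊢
  simp only [smul_mul_assoc, map_smul, _root_.smul_apply, smul_eq_mul] at this
  have hi : 0 < ‖S‖⁻¹ := by positivity
  exact pos_of_mul_pos_right (pos_of_mul_pos_right this hi.le) hi.le

/-- On an open neighborhood `U` of `SO(3)` inside `GL₊(3)`, the zero set of
the Hessian quadratic form `G ↦ ∂²_{F₁²}D²(F,F)[G,G]` equals `{A·F : A skew}`, which
coincides with `F⁻ᵀ·{B : B skew}`. -/
theorem statement1 (D : Mat3 → Mat3 → ℝ) (hD : IsDissipationDensity D) :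
    ∃ U : Set Mat3, IsOpen U ∧ SO3 ⊆ U ∧ U ⊆ GLp ∧
      ∀ F ∈ U,
        ({G : Mat3 | D2bil D F F G G = 0} = {G : Mat3 | ∃ A : Mat3, Aᵀ = -A ∧ G = A * F}) ∧
        ({G : Mat3 | ∃ A : Mat3, Aᵀ = -A ∧ G = A * F}
          = {G : Mat3 | ∃ B : Mat3, Bᵀ = -B ∧ G = (Fᵀ)⁻¹ * B}) := by
  obtain ⟨V, hVo, hVs, hVG, hVc⟩ := hD.smooth
  have hV : ∀ F, (F, F) ∈ V → ContDiffAt ℝ 3 (Phi D) (F, F) := fun F hF =>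
    hVc.contDiffAt (hVo.mem_nhds hF)
  have hSO : ∀ Q ∈ SO3, ContDiffAt ℝ 3 (Phi D) (Q, Q) := fun Q hQ => hV Q (hVs ⟨hQ, hQ⟩)
  set P : Set Mat3 := {F | ∀ S : Mat3, Sᵀ = S → S ≠ 0 → 0 < D2bil D F F (S * F) (S * F)} with hP
  have hdo : IsOpen {F : Mat3 | (F, F) ∈ V} := hVo.preimage (continuous_id.prodMk continuous_id)
  refine ⟨interior P ∩ {F : Mat3 | (F, F) ∈ V}, isOpen_interior.inter hdo,
    fun Q hQ => ⟨mem_interior_iff_mem_nhds.2 (pos_near D hD hQ hSO), hVs ⟨hQ, hQ⟩⟩,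
    fun F hF => (hVG hF.2).1, ?_⟩
  rintro F ⟨hFP, hFV⟩
  have hFG : F ∈ GLp := (hVG hFV).1
  have hFc := hV F hFV
  have hFP : F ∈ P := interior_subset hFP
  have hu : IsUnit F.det := (ne_of_gt hFG).isUnit
  have huT : IsUnit (Fᵀ).det := by simpa using hu
  constructor
  · ext G
    simp only [Set.mem_setOf_eq]
    constructor
    · intro h0
      set M := G * F⁻¹ with hM
      have hG : G = M * F := by rw [hM, mul_assoc, nonsing_inv_mul _ hu, mul_one]
      set A := (2 : ℝ)⁻¹ • (M - Mᵀ) with hA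
      set S := (2 : ℝ)⁻¹ • (M + Mᵀ) with hS
      have hAS : M = A + S := by rw [hA, hS]; module
      have hAT : Aᵀ = -A := by
        rw [hA, transpose_smul, transpose_sub, transpose_transpose]; module
      have hST : Sᵀ = S := by
        rw [hS, transpose_smul, transpose_add, transpose_transpose, add_comm]
      have e : G = A * F + S * F := by rw [← add_mul, ← hAS, hG]
      have h1 := hess_skew D hD hFG hFc A (S * F) hAT
      rw [← e, h0] at h1
      have hS0 : S = 0 := by
        by_contra hne
        exact (hFP S hST hne).ne h1
      exact ⟨A, hAT, by rw [e, hS0]; simp⟩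
    · rintro ⟨A, hA, rfl⟩
      have h1 := hess_skew D hD hFG hFc A 0 hA
      rw [add_zero] at h1
      rw [h1, D2bil_eq]; simp
  · ext G
    simp only [Set.mem_setOf_eq]
    constructor
    · rintro ⟨A, hA, rfl⟩
      refine ⟨Fᵀ * A * F, by simp [transpose_mul, hA, mul_assoc], ?_⟩
      rw [← mul_assoc, ← mul_assoc, nonsing_inv_mul _ huT, one_mul]
    · rintro ⟨B, hB, rfl⟩
      refine ⟨(Fᵀ)⁻¹ * B * F⁻¹, ?_, ?_⟩
      · simp [transpose_mul, hB, mul_assoc, transpose_nonsing_inv]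
      · rw [mul_assoc, nonsing_inv_mul _ hu, mul_one]
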